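/- Let (X, 𝓑, μ, T) be an m.t.d.s. and 𝓤 a cover of X. Then h_μ^−(𝓤, T) = lim_{n→∞} (1/n)·h_μ^+(𝓤_0^{n−1}, T^n), where 𝓤_0^{n−1} (formed using T) is viewed as a cover of the system (X, 𝓑, μ, T^n). -/

import Mathlib

open MeasureTheory Filter Topology
open scoped Classical

variable {X : Type*} [MeasurableSpace X]

noncomputable def cJoin (U V : Finset (Set X)) : Finset (Set X) :=
  (U ×ˢ V).image fun p => p.1 ∩ p.2

noncomputable def preC (S : X → X) (U : Finset (Set X)) : Finset (Set X) :=
  U.image fun A => S ⁻¹' A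

noncomputable def joinN (S : X → X) (U : Finset (Set X)) : ℕ → Finset (Set X)
  | 0 => {Set.univ}
  | n + 1 => cJoin (joinN S U n) (preC (S^[n]) U)

def IsMCover (U : Finset (Set X)) : Prop :=
  (∀ A ∈ U, MeasurableSet A) ∧ ⋃₀ (U : Set (Set X)) = Set.univ

def IsMPartition (U : Finset (Set X)) : Prop :=
  IsMCover U ∧ ∀ A ∈ U, ∀ B ∈ U, A ≠ B → Disjoint A B

def Refines (α U : Finset (Set X)) : Prop := ∀ A ∈ α, ∃ B ∈ U, A ⊆ B

noncomputable def entPart (μ : Measure X) (α : Finset (Set X)) : ℝ :=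
  ∑ A ∈ α, Real.negMulLog (μ A).toReal

noncomputable def entCover (μ : Measure X) (U : Finset (Set X)) : ℝ :=
  sInf {h | ∃ α : Finset (Set X), IsMPartition α ∧ Refines α U ∧ h = entPart μ α}

noncomputable def hPart (μ : Measure X) (S : X → X) (α : Finset (Set X)) : ℝ :=
  limUnder atTop fun n : ℕ => entPart μ (joinN S α n) / n

noncomputable def hPlusC (μ : Measure X) (S : X → X) (U : Finset (Set X)) : ℝ :=
  sInf {h | ∃ α : Finset (Set X), IsMPartition α ∧ Refines α U ∧ h = hPart μ S α}

noncomputable def hMinusC (μ : Measure X) (S : X → X) (U : Finset (Set X)) : ℝ :=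
  limUnder atTop fun n : ℕ => entCover μ (joinN S U n) / n

noncomputable def covN (μ : Measure X) (V : Finset (Set X)) (ε : ℝ) : ℕ :=
  sInf {m | ∃ W ⊆ V, W.card = m ∧ 1 - ε < (μ (⋃₀ (W : Set (Set X)))).toReal}

noncomputable def covNfull (V : Finset (Set X)) : ℕ :=
  sInf {m | ∃ W ⊆ V, W.card = m ∧ ⋃₀ (W : Set (Set X)) = Set.univ}

theorem mem_cJoin {X : Type*} {U V : Finset (Set X)} {C : Set X} :
    C ∈ cJoin U V ↔ ∃ A ∈ U, ∃ B ∈ V, A ∩ B = C := by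
  simp [cJoin, and_assoc]

theorem mem_preC {X : Type*} {S : X → X} {U : Finset (Set X)} {C : Set X} :
    C ∈ preC S U ↔ ∃ A ∈ U, S ⁻¹' A = C := by
  simp [preC]

theorem cJoin_assoc {X : Type*} (U V W : Finset (Set X)) :
    cJoin (cJoin U V) W = cJoin U (cJoin V W) := by
  ext C
  simp only [mem_cJoin]
  constructor
  · rintro ⟨_, ⟨A, hA, B, hB, rfl⟩, D, hD, rfl⟩
    exact ⟨A, hA, _, ⟨B, hB, D, hD, rfl⟩, (Set.inter_assoc _ _ _).symm⟩
  · rintro ⟨A, hA, _, ⟨B, hB, D, hD, rfl⟩, rfl⟩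
    exact ⟨_, ⟨A, hA, B, hB, rfl⟩, D, hD, Set.inter_assoc _ _ _⟩

theorem cJoin_univ_left {X : Type*} (U : Finset (Set X)) : cJoin {Set.univ} U = U := by
  ext C
  simp [mem_cJoin]

theorem cJoin_univ_right {X : Type*} (U : Finset (Set X)) : cJoin U {Set.univ} = U := by
  ext C
  simp [mem_cJoin]

theorem preC_cJoin {X : Type*} (S : X → X) (U V : Finset (Set X)) :
    preC S (cJoin U V) = cJoin (preC S U) (preC S V) := by
  ext C
  simp only [mem_cJoin, mem_preC]
  constructor
  · rintro ⟨_, ⟨A, hA, B, hB, rfl⟩, rfl⟩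
    exact ⟨_, ⟨A, hA, rfl⟩, _, ⟨B, hB, rfl⟩, rfl⟩
  · rintro ⟨_, ⟨A, hA, rfl⟩, _, ⟨B, hB, rfl⟩, rfl⟩
    exact ⟨_, ⟨A, hA, B, hB, rfl⟩, rfl⟩

theorem preC_preC {X : Type*} (S R : X → X) (U : Finset (Set X)) :
    preC S (preC R U) = preC (R ∘ S) U := by
  ext C
  simp [mem_preC, Set.preimage_comp]

theorem preC_univ {X : Type*} (S : X → X) : preC S {Set.univ} = {Set.univ} := by
  simp [preC]

theorem joinN_add {X : Type*} (S : X → X) (U : Finset (Set X)) (m n : ℕ) :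
    joinN S U (m + n) = cJoin (joinN S U m) (preC (S^[m]) (joinN S U n)) := by
  induction n with
  | zero => simp [joinN, preC_univ, cJoin_univ_right]
  | succ n ih =>
    rw [← add_assoc, joinN, ih, joinN, preC_cJoin, preC_preC, cJoin_assoc,
      ← Function.iterate_add, add_comm n m]

theorem joinN_one {X : Type*} (S : X → X) (U : Finset (Set X)) : joinN S U 1 = U := by
  simp [joinN, cJoin_univ_left, preC]

theorem joinN_iterate_joinN {X : Type*} (S : X → X) (U : Finset (Set X)) (n k : ℕ) :
    joinN (S^[n]) (joinN S U n) k = joinN S U (n * k) := by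
  induction k with
  | zero => rfl
  | succ k ih => rw [joinN, ih, Nat.mul_succ, joinN_add, ← Function.iterate_mul]

theorem IsMPartition.univ : IsMPartition ({Set.univ} : Finset (Set X)) := by
  refine ⟨⟨by simp, by simp⟩, ?_⟩
  simp

theorem IsMCover.cJoin {U V : Finset (Set X)} (hU : IsMCover U) (hV : IsMCover V) :
    IsMCover (cJoin U V) := by
  constructor
  · intro C hC
    obtain ⟨A, hA, B, hB, rfl⟩ := mem_cJoin.1 hC
    exact (hU.1 A hA).inter (hV.1 B hB)
  · refine Set.eq_univ_of_forall fun x => ?_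
    obtain ⟨A, hA, hxA⟩ : x ∈ ⋃₀ (U : Set (Set X)) := hU.2 ▸ Set.mem_univ x
    obtain ⟨B, hB, hxB⟩ : x ∈ ⋃₀ (V : Set (Set X)) := hV.2 ▸ Set.mem_univ x
    exact ⟨A ∩ B, mem_cJoin.2 ⟨A, hA, B, hB, rfl⟩, hxA, hxB⟩

theorem IsMCover.preC {U : Finset (Set X)} (hU : IsMCover U) {S : X → X} (hS : Measurable S) :
    IsMCover (preC S U) := by
  constructor
  · intro C hC
    obtain ⟨A, hA, rfl⟩ := mem_preC.1 hC
    exact hS (hU.1 A hA)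
  · refine Set.eq_univ_of_forall fun x => ?_
    obtain ⟨A, hA, hxA⟩ : S x ∈ ⋃₀ (U : Set (Set X)) := hU.2 ▸ Set.mem_univ (S x)
    exact ⟨S ⁻¹' A, mem_preC.2 ⟨A, hA, rfl⟩, hxA⟩

theorem IsMCover.joinN {U : Finset (Set X)} (hU : IsMCover U) {S : X → X} (hS : Measurable S)
    (n : ℕ) : IsMCover (joinN S U n) := by
  induction n with
  | zero => exact IsMPartition.univ.1
  | succ n ih => exact ih.cJoin (hU.preC (hS.iterate n))

theorem IsMPartition.cJoin {α β : Finset (Set X)} (hα : IsMPartition α) (hβ : IsMPartition β) :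
    IsMPartition (cJoin α β) := by
  refine ⟨hα.1.cJoin hβ.1, fun C hC D hD hCD => ?_⟩
  obtain ⟨A, hA, B, hB, rfl⟩ := mem_cJoin.1 hC
  obtain ⟨A', hA', B', hB', rfl⟩ := mem_cJoin.1 hD
  by_cases h : A = A'
  · have hB_ne : B ≠ B' := by
      rintro rfl
      exact hCD (by rw [h])
    exact (hβ.2 B hB B' hB' hB_ne).mono Set.inter_subset_right Set.inter_subset_right
  · exact (hα.2 A hA A' hA' h).mono Set.inter_subset_left Set.inter_subset_left

theorem IsMPartition.preC {α : Finset (Set X)} (hα : IsMPartition α) {S : X → X}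
    (hS : Measurable S) : IsMPartition (preC S α) := by
  refine ⟨hα.1.preC hS, fun C hC D hD hCD => ?_⟩
  obtain ⟨A, hA, rfl⟩ := mem_preC.1 hC
  obtain ⟨A', hA', rfl⟩ := mem_preC.1 hD
  exact (hα.2 A hA A' hA' fun h => hCD (by rw [h])).preimage S

theorem IsMPartition.joinN {α : Finset (Set X)} (hα : IsMPartition α) {S : X → X}
    (hS : Measurable S) (n : ℕ) : IsMPartition (joinN S α n) := by
  induction n with
  | zero => exact IsMPartition.univ
  | succ n ih => exact ih.cJoin (hα.preC (hS.iterate n))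

theorem Refines.cJoin {X : Type*} {α β U V : Finset (Set X)} (h : Refines α U) (h' : Refines β V) :
    Refines (cJoin α β) (cJoin U V) := by
  intro C hC
  obtain ⟨A, hA, B, hB, rfl⟩ := mem_cJoin.1 hC
  obtain ⟨A', hA', hAA'⟩ := h A hA
  obtain ⟨B', hB', hBB'⟩ := h' B hB
  exact ⟨A' ∩ B', mem_cJoin.2 ⟨A', hA', B', hB', rfl⟩, Set.inter_subset_inter hAA' hBB'⟩

theorem Refines.preC {X : Type*} {α U : Finset (Set X)} (h : Refines α U) (S : X → X) :
    Refines (preC S α) (preC S U) := by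
  intro C hC
  obtain ⟨A, hA, rfl⟩ := mem_preC.1 hC
  obtain ⟨A', hA', hAA'⟩ := h A hA
  exact ⟨S ⁻¹' A', mem_preC.2 ⟨A', hA', rfl⟩, Set.preimage_mono hAA'⟩

theorem Refines.joinN {X : Type*} {α U : Finset (Set X)} (h : Refines α U) (S : X → X) (n : ℕ) :
    Refines (joinN S α n) (joinN S U n) := by
  induction n with
  | zero => exact fun A hA => ⟨A, hA, subset_rfl⟩
  | succ n ih => exact ih.cJoin (h.preC _)

/-- Every finite measurable cover is refined by the partition into its atoms. -/
theorem IsMCover.exists_isMPartition_refines {U : Finset (Set X)} (hU : IsMCover U) :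
    ∃ α, IsMPartition α ∧ Refines α U := by
  let atom : Finset (Set X) → Set X := fun W => {x | ∀ A ∈ U, x ∈ A ↔ A ∈ W}
  refine ⟨(U.powerset.filter Finset.Nonempty).image atom, ⟨⟨?_, ?_⟩, ?_⟩, ?_⟩
  · intro C hC
    obtain ⟨W, -, rfl⟩ := Finset.mem_image.1 hC
    have h : atom W = ⋂ A ∈ U, {x | x ∈ A ↔ A ∈ W} := by
      ext x
      simp [atom]
    rw [h]
    refine Finset.measurableSet_biInter _ fun A hA => ?_
    by_cases hW : A ∈ W
    · simpa [hW] using hU.1 A hA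
    · simp only [hW, iff_false]
      exact (hU.1 A hA).compl
  · refine Set.eq_univ_of_forall fun x => ?_
    obtain ⟨A, hA, hxA⟩ : x ∈ ⋃₀ (U : Set (Set X)) := hU.2 ▸ Set.mem_univ x
    refine ⟨atom (U.filter fun A => x ∈ A), Finset.mem_coe.2 (Finset.mem_image_of_mem _ ?_), ?_⟩
    · simp only [Finset.mem_filter, Finset.mem_powerset, Finset.filter_subset, true_and]
      exact ⟨A, Finset.mem_filter.2 ⟨hA, hxA⟩⟩
    · intro B hB
      simp [hB]
  · intro C hC D hD hCD
    obtain ⟨W, hW, rfl⟩ := Finset.mem_image.1 hC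
    obtain ⟨V, hV, rfl⟩ := Finset.mem_image.1 hD
    simp only [Finset.mem_filter, Finset.mem_powerset] at hW hV
    refine Set.disjoint_left.2 fun x hx hx' => hCD ?_
    have hWV : W = V := by
      ext A
      constructor
      · exact fun h => (hx' A (hW.1 h)).1 ((hx A (hW.1 h)).2 h)
      · exact fun h => (hx A (hV.1 h)).1 ((hx' A (hV.1 h)).2 h)
    rw [hWV]
  · intro C hC
    obtain ⟨W, hW, rfl⟩ := Finset.mem_image.1 hC
    simp only [Finset.mem_filter, Finset.mem_powerset] at hW
    obtain ⟨hWU, A, hA⟩ := hW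
    exact ⟨A, hWU hA, fun x hx => (hx A (hWU hA)).2 hA⟩

theorem negMulLog_measure_nonneg (μ : Measure X) [IsProbabilityMeasure μ] (A : Set X) :
    0 ≤ Real.negMulLog (μ A).toReal :=
  Real.negMulLog_nonneg ENNReal.toReal_nonneg measureReal_le_one

theorem entPart_nonneg (μ : Measure X) [IsProbabilityMeasure μ] (α : Finset (Set X)) :
    0 ≤ entPart μ α :=
  Finset.sum_nonneg fun A _ => negMulLog_measure_nonneg μ A

theorem sum_image_le_sum_comp {ι κ : Type*} (s : Finset ι) (g : ι → κ) (f : κ → ℝ)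
    (hf : ∀ k, 0 ≤ f k) : ∑ k ∈ s.image g, f k ≤ ∑ i ∈ s, f (g i) := by
  rw [← Finset.sum_fiberwise_of_maps_to (t := s.image g) (g := g)
    fun i hi => Finset.mem_image_of_mem g hi]
  refine Finset.sum_le_sum fun k hk => ?_
  obtain ⟨i, hi, rfl⟩ := Finset.mem_image.1 hk
  exact Finset.single_le_sum (f := fun j => f (g j)) (fun j _ => hf _)
    (Finset.mem_filter.2 ⟨hi, rfl⟩)

theorem entPart_preC_le {μ : Measure X} [IsProbabilityMeasure μ] {S : X → X}
    (hS : MeasurePreserving S μ μ) {α : Finset (Set X)} (hα : IsMCover α) :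
    entPart μ (preC S α) ≤ entPart μ α := by
  refine (sum_image_le_sum_comp _ _ _ (negMulLog_measure_nonneg μ)).trans_eq ?_
  refine Finset.sum_congr rfl fun A hA => ?_
  rw [hS.measure_preimage (hα.1 A hA).nullMeasurableSet]

theorem IsMPartition.sum_measure_inter {β : Finset (Set X)} (hβ : IsMPartition β) (μ : Measure X)
    [IsProbabilityMeasure μ] {A : Set X} (hA : MeasurableSet A) :
    ∑ B ∈ β, (μ (A ∩ B)).toReal = (μ A).toReal := by
  rw [← ENNReal.toReal_sum fun _ _ => measure_ne_top _ _, ← measure_biUnion_finset]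
  · congr 2
    rw [← Set.inter_iUnion₂]
    have h : ⋃ B ∈ β, B = Set.univ := by rw [← hβ.1.2, Set.sUnion_eq_biUnion]; rfl
    rw [h, Set.inter_univ]
  · intro B hB B' hB' hne
    exact (hβ.2 B hB B' hB' hne).mono Set.inter_subset_right Set.inter_subset_right
  · exact fun B hB => hA.inter (hβ.1.1 B hB)

theorem negMulLog_le_of_le {p a b : ℝ} (hp : 0 ≤ p) (ha : p ≤ a) (hb : p ≤ b) :
    Real.negMulLog p ≤ -(p * Real.log a) - p * Real.log b + (a * b - p) := by
  rcases hp.eq_or_lt with rfl | hp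
  · simpa using mul_nonneg ha hb
  · have ha' := hp.trans_le ha
    have hb' := hp.trans_le hb
    have h := Real.log_le_sub_one_of_pos (div_pos (mul_pos ha' hb') hp)
    rw [Real.log_div (mul_pos ha' hb').ne' hp.ne', Real.log_mul ha'.ne' hb'.ne'] at h
    have h' := mul_le_mul_of_nonneg_left h hp.le
    have h'' : p * (a * b / p - 1) = a * b - p := by field_simp
    rw [h''] at h'
    rw [Real.negMulLog]
    linarith

theorem entPart_cJoin_le (μ : Measure X) [IsProbabilityMeasure μ] {α β : Finset (Set X)}
    (hα : IsMPartition α) (hβ : IsMPartition β) :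
    entPart μ (cJoin α β) ≤ entPart μ α + entPart μ β := by
  have hle : entPart μ (cJoin α β) ≤ ∑ A ∈ α, ∑ B ∈ β, Real.negMulLog (μ (A ∩ B)).toReal := by
    rw [← Finset.sum_product']
    exact sum_image_le_sum_comp _ _ _ (negMulLog_measure_nonneg μ)
  have hrow : ∀ A ∈ α, ∑ B ∈ β, (μ (A ∩ B)).toReal = (μ A).toReal :=
    fun A hA => hβ.sum_measure_inter μ (hα.1.1 A hA)
  have hcol : ∀ B ∈ β, ∑ A ∈ α, (μ (A ∩ B)).toReal = (μ B).toReal := by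
    intro B hB
    simpa only [Set.inter_comm] using hα.sum_measure_inter μ (hβ.1.1 B hB)
  have hone : ∀ {γ : Finset (Set X)}, IsMPartition γ → ∑ A ∈ γ, (μ A).toReal = 1 := by
    intro γ hγ
    simpa using hγ.sum_measure_inter μ MeasurableSet.univ
  refine hle.trans ((Finset.sum_le_sum fun A _ => Finset.sum_le_sum fun B _ =>
    negMulLog_le_of_le ENNReal.toReal_nonneg
      (measureReal_mono (μ := μ) (Set.inter_subset_left (s := A) (t := B)))
      (measureReal_mono (μ := μ) (Set.inter_subset_right (s := A) (t := B)))).trans_eq ?_)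
  simp only [Measure.real, Finset.sum_add_distrib, Finset.sum_sub_distrib,
    Finset.sum_neg_distrib]
  have h1 : ∑ A ∈ α, ∑ B ∈ β, (μ (A ∩ B)).toReal * Real.log (μ A).toReal
      = ∑ A ∈ α, (μ A).toReal * Real.log (μ A).toReal :=
    Finset.sum_congr rfl fun A hA => by rw [← Finset.sum_mul, hrow A hA]
  have h2 : ∑ A ∈ α, ∑ B ∈ β, (μ (A ∩ B)).toReal * Real.log (μ B).toReal
      = ∑ B ∈ β, (μ B).toReal * Real.log (μ B).toReal := by
    rw [Finset.sum_comm]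
    exact Finset.sum_congr rfl fun B hB => by rw [← Finset.sum_mul, hcol B hB]
  have h3 : ∑ A ∈ α, ∑ B ∈ β, (μ A).toReal * (μ B).toReal = 1 := by
    rw [← Finset.sum_mul_sum, hone hα, hone hβ, one_mul]
  have h4 : ∑ A ∈ α, ∑ B ∈ β, (μ (A ∩ B)).toReal = 1 := by
    rw [Finset.sum_congr rfl hrow, hone hα]
  rw [h1, h2, h3, h4]
  simp only [entPart, Real.negMulLog, neg_mul, Finset.sum_neg_distrib]
  ring

theorem entCover_le {μ : Measure X} [IsProbabilityMeasure μ] {α U : Finset (Set X)}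
    (hα : IsMPartition α) (h : Refines α U) : entCover μ U ≤ entPart μ α :=
  csInf_le ⟨0, by rintro _ ⟨β, -, -, rfl⟩; exact entPart_nonneg μ β⟩ ⟨α, hα, h, rfl⟩

theorem le_entCover {μ : Measure X} {U : Finset (Set X)} (hU : IsMCover U) {c : ℝ}
    (h : ∀ α, IsMPartition α → Refines α U → c ≤ entPart μ α) : c ≤ entCover μ U := by
  obtain ⟨α, hα, hαU⟩ := hU.exists_isMPartition_refines
  refine le_csInf ⟨_, α, hα, hαU, rfl⟩ ?_
  rintro _ ⟨β, hβ, hβU, rfl⟩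
  exact h β hβ hβU

theorem entCover_nonneg {μ : Measure X} [IsProbabilityMeasure μ] {U : Finset (Set X)}
    (hU : IsMCover U) : 0 ≤ entCover μ U :=
  le_entCover hU fun α _ _ => entPart_nonneg μ α

theorem subadditive_entPart_joinN {μ : Measure X} [IsProbabilityMeasure μ] {S : X → X}
    (hS : MeasurePreserving S μ μ) {α : Finset (Set X)} (hα : IsMPartition α) :
    Subadditive fun n => entPart μ (joinN S α n) := by
  intro m n
  have hn := hα.joinN hS.measurable n
  dsimp only
  rw [joinN_add]
  refine (entPart_cJoin_le μ (hα.joinN hS.measurable m)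
    (hn.preC (hS.measurable.iterate m))).trans ?_
  gcongr
  exact entPart_preC_le (hS.iterate m) hn.1

theorem subadditive_entCover_joinN {μ : Measure X} [IsProbabilityMeasure μ] {S : X → X}
    (hS : MeasurePreserving S μ μ) {U : Finset (Set X)} (hU : IsMCover U) :
    Subadditive fun n => entCover μ (joinN S U n) := by
  intro m n
  dsimp only
  rw [← sub_le_iff_le_add']
  refine le_entCover (hU.joinN hS.measurable n) fun β hβ hβU => ?_
  rw [sub_le_iff_le_add', ← sub_le_iff_le_add]
  refine le_entCover (hU.joinN hS.measurable m) fun α hα hαU => ?_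
  rw [sub_le_iff_le_add, joinN_add]
  have hpre := hβ.preC (hS.measurable.iterate m)
  refine (entCover_le (hα.cJoin hpre) (hαU.cJoin (hβU.preC _))).trans ?_
  refine (entPart_cJoin_le μ hα hpre).trans ?_
  gcongr
  exact entPart_preC_le (hS.iterate m) hβ.1

theorem bddBelow_range_div_of_nonneg {u : ℕ → ℝ} (hu : ∀ n, 0 ≤ u n) :
    BddBelow (Set.range fun n => u n / n) :=
  ⟨0, by rintro _ ⟨n, rfl⟩; exact div_nonneg (hu n) n.cast_nonneg⟩

theorem tendsto_hPart {μ : Measure X} [IsProbabilityMeasure μ] {S : X → X}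
    (hS : MeasurePreserving S μ μ) {α : Finset (Set X)} (hα : IsMPartition α) :
    Tendsto (fun n : ℕ => entPart μ (joinN S α n) / n) atTop (𝓝 (hPart μ S α)) :=
  tendsto_nhds_limUnder ⟨_, (subadditive_entPart_joinN hS hα).tendsto_lim
    (bddBelow_range_div_of_nonneg fun _ => entPart_nonneg μ _)⟩

theorem hPart_le_entPart {μ : Measure X} [IsProbabilityMeasure μ] {S : X → X}
    (hS : MeasurePreserving S μ μ) {α : Finset (Set X)} (hα : IsMPartition α) :
    hPart μ S α ≤ entPart μ α := by
  have hb := bddBelow_range_div_of_nonneg fun n => entPart_nonneg μ (joinN S α n)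
  have hsub := subadditive_entPart_joinN hS hα
  rw [tendsto_nhds_unique (tendsto_hPart hS hα) (hsub.tendsto_lim hb)]
  simpa [joinN_one] using hsub.lim_le_div hb one_ne_zero

theorem tendsto_hMinusC {μ : Measure X} [IsProbabilityMeasure μ] {S : X → X}
    (hS : MeasurePreserving S μ μ) {U : Finset (Set X)} (hU : IsMCover U) :
    Tendsto (fun n : ℕ => entCover μ (joinN S U n) / n) atTop (𝓝 (hMinusC μ S U)) :=
  tendsto_nhds_limUnder ⟨_, (subadditive_entCover_joinN hS hU).tendsto_lim
    (bddBelow_range_div_of_nonneg fun n => entCover_nonneg (hU.joinN hS.measurable n))⟩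

theorem hPart_nonneg {μ : Measure X} [IsProbabilityMeasure μ] {S : X → X}
    (hS : MeasurePreserving S μ μ) {α : Finset (Set X)} (hα : IsMPartition α) :
    0 ≤ hPart μ S α :=
  ge_of_tendsto' (tendsto_hPart hS hα) fun n => div_nonneg (entPart_nonneg μ _) n.cast_nonneg

theorem hPlusC_le_entCover {μ : Measure X} [IsProbabilityMeasure μ] {S : X → X}
    (hS : MeasurePreserving S μ μ) {U : Finset (Set X)} (hU : IsMCover U) :
    hPlusC μ S U ≤ entCover μ U := by
  refine le_entCover hU fun α hα hαU => le_trans ?_ (hPart_le_entPart hS hα)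
  exact csInf_le ⟨0, by rintro _ ⟨β, hβ, -, rfl⟩; exact hPart_nonneg hS hβ⟩ ⟨α, hα, hαU, rfl⟩

theorem hMinusC_le_hPlusC {μ : Measure X} [IsProbabilityMeasure μ] {S : X → X}
    (hS : MeasurePreserving S μ μ) {U : Finset (Set X)} (hU : IsMCover U) :
    hMinusC μ S U ≤ hPlusC μ S U := by
  obtain ⟨α, hα, hαU⟩ := hU.exists_isMPartition_refines
  refine le_csInf ⟨_, α, hα, hαU, rfl⟩ ?_
  rintro _ ⟨β, hβ, hβU, rfl⟩
  refine le_of_tendsto_of_tendsto' (tendsto_hMinusC hS hU) (tendsto_hPart hS hβ) fun k => ?_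
  gcongr
  exact entCover_le (hβ.joinN hS.measurable k) (hβU.joinN S k)

theorem hMinusC_iterate_joinN {μ : Measure X} [IsProbabilityMeasure μ] {S : X → X}
    (hS : MeasurePreserving S μ μ) {U : Finset (Set X)} (hU : IsMCover U) {n : ℕ} (hn : 0 < n) :
    hMinusC μ (S^[n]) (joinN S U n) = n * hMinusC μ S U := by
  refine tendsto_nhds_unique (tendsto_hMinusC (hS.iterate n) (hU.joinN hS.measurable n)) ?_
  have h := ((tendsto_hMinusC hS hU).comp (tendsto_id.const_mul_atTop' hn)).const_mul (n : ℝ)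
  refine h.congr fun k => ?_
  have hn' : (n : ℝ) ≠ 0 := by exact_mod_cast hn.ne'
  simp only [Function.comp_apply, id_eq, joinN_iterate_joinN, Nat.cast_mul]
  rw [← mul_div_assoc, mul_div_mul_left _ _ hn']

/-- For an m.t.d.s. `(X, 𝓑, μ, T)` and a cover `𝓤`,
`h_μ⁻(𝓤, T) = lim_n (1/n)·h_μ⁺(𝓤₀^{n−1}, Tⁿ)`. -/
theorem hMinus_eq_lim_hPlus_power {X : Type*} [MeasurableSpace X] [StandardBorelSpace X]
    (μ : Measure X) [IsProbabilityMeasure μ] (T : X ≃ᵐ X)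
    (hT : MeasurePreserving ⇑T μ μ)
    (U : Finset (Set X)) (hU : IsMCover U) :
    Tendsto (fun n : ℕ => hPlusC μ ((⇑T)^[n]) (joinN ⇑T U n) / n) atTop
      (𝓝 (hMinusC μ ⇑T U)) := by
  refine tendsto_of_tendsto_of_tendsto_of_le_of_le' tendsto_const_nhds (tendsto_hMinusC hT hU)
    ?_ ?_
  · filter_upwards [eventually_gt_atTop 0] with n hn
    rw [le_div_iff₀ (by exact_mod_cast hn), mul_comm, ← hMinusC_iterate_joinN hT hU hn]
    exact hMinusC_le_hPlusC (hT.iterate n) (hU.joinN hT.measurable n)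
  · refine Eventually.of_forall fun n => ?_
    gcongr
    exact hPlusC_le_entCover (hT.iterate n) (hU.joinN hT.measurable n)
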